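/- arXiv:math/0609676 — 4 statements merged into one kernel-verified Lean document; each statement's English description precedes it below -/
import Mathlib

section
/- Let h be a Haar state on A, and let u ∈ M_m(A) and v ∈ M_n(A) be irreducible unitary corepresentations of A that are inequivalent. Then for all indices m', k ∈ {1,…,m} and n', l ∈ {1,…,n}: h(u_{m'k}·star(v_{n'l})) = 0 and h(star(u_{km'})·v_{ln'}) = 0. -/
open scoped TensorProduct BigOperators ComplexOrder

/-- Apply a functional to the first tensor factor of the comultiplication: `a ↦ (φ ⊗ id)(Δ a)`. -/
noncomputable def applyFst {A : Type*} [Ring A] [Bialgebra ℂ A] (φ : A →ₗ[ℂ] ℂ) : A →ₗ[ℂ] A :=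
  (TensorProduct.lid ℂ A).toLinearMap ∘ₗ LinearMap.rTensor A φ ∘ₗ Coalgebra.comul

/-- Apply a functional to the second tensor factor of the comultiplication: `a ↦ (id ⊗ φ)(Δ a)`. -/
noncomputable def applySnd {A : Type*} [Ring A] [Bialgebra ℂ A] (φ : A →ₗ[ℂ] ℂ) : A →ₗ[ℂ] A :=
  (TensorProduct.rid ℂ A).toLinearMap ∘ₗ LinearMap.lTensor A φ ∘ₗ Coalgebra.comul

/-- `h` is a Haar state: normalized, right- and left-invariant, and positive. -/
def IsHaarState {A : Type*} [Ring A] [StarRing A] [Bialgebra ℂ A] (h : A →ₗ[ℂ] ℂ) : Prop :=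
  h 1 = 1 ∧ (∀ a : A, applySnd h a = h a • (1 : A)) ∧ (∀ a : A, applyFst h a = h a • (1 : A)) ∧
    ∀ a : A, 0 ≤ h (star a * a)

/-- The comultiplication is a `*`-homomorphism: if `Δ x = Σ aᵢ ⊗ bᵢ` then
`Δ (star x) = Σ star aᵢ ⊗ star bᵢ`. -/
def ComulStar (A : Type*) [Ring A] [StarRing A] [Bialgebra ℂ A] : Prop :=
  ∀ (x : A) (n : ℕ) (a b : Fin n → A),
    Coalgebra.comul (R := ℂ) x = ∑ i, a i ⊗ₜ[ℂ] b i →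
      Coalgebra.comul (R := ℂ) (star x) = ∑ i, star (a i) ⊗ₜ[ℂ] star (b i)

/-- `u` is a corepresentation matrix: `Δ(uᵢⱼ) = Σₖ uᵢₖ ⊗ uₖⱼ` and `ε(uᵢⱼ) = δᵢⱼ`. -/
def IsCorep {A : Type*} [Ring A] [Bialgebra ℂ A] {d : ℕ} (u : Matrix (Fin d) (Fin d) A) : Prop :=
  (∀ i j, Coalgebra.comul (R := ℂ) (u i j) = ∑ k, u i k ⊗ₜ[ℂ] u k j) ∧
    ∀ i j, Coalgebra.counit (R := ℂ) (u i j) = if i = j then 1 else 0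

/-- `u` is a unitary matrix over the `*`-algebra `A`. -/
def IsUnitaryMatrix {A : Type*} [Ring A] [StarRing A] {d : ℕ}
    (u : Matrix (Fin d) (Fin d) A) : Prop :=
  (∀ i j, ∑ k, u i k * star (u j k) = if i = j then (1 : A) else 0) ∧
    ∀ i j, ∑ k, star (u k i) * u k j = if i = j then (1 : A) else 0

/-- The scalar matrix `T` intertwines the corepresentations `u` and `v`. -/
def Intertwines {A : Type*} [Ring A] [Algebra ℂ A] {m n : ℕ}
    (u : Matrix (Fin m) (Fin m) A) (v : Matrix (Fin n) (Fin n) A)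
    (T : Matrix (Fin m) (Fin n) ℂ) : Prop :=
  ∀ i j, ∑ k, T k j • u i k = ∑ k, T i k • v k j

/-- A corepresentation is irreducible if its only self-intertwiners are scalar multiples of the
identity. -/
def IsIrreducibleCorep {A : Type*} [Ring A] [Algebra ℂ A] {d : ℕ}
    (u : Matrix (Fin d) (Fin d) A) : Prop :=
  ∀ T : Matrix (Fin d) (Fin d) ℂ, Intertwines u u T →
    ∃ c : ℂ, T = c • (1 : Matrix (Fin d) (Fin d) ℂ)

theorem IsCorep.comul_star {A : Type*} [Ring A] [StarRing A] [Bialgebra ℂ A] (hstar : ComulStar A)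
    {d : ℕ} {u : Matrix (Fin d) (Fin d) A} (hu : IsCorep u) (i j : Fin d) :
    Coalgebra.comul (R := ℂ) (star (u i j)) = ∑ k, star (u i k) ⊗ₜ[ℂ] star (u k j) :=
  hstar _ d _ _ (hu.1 i j)

theorem applySnd_mul_of_comul_eq {A ι κ : Type*} [Ring A] [Bialgebra ℂ A] [Fintype ι] [Fintype κ]
    (φ : A →ₗ[ℂ] ℂ) {x y : A} {a a' : ι → A} {b b' : κ → A}
    (hx : Coalgebra.comul (R := ℂ) x = ∑ p, a p ⊗ₜ[ℂ] a' p)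
    (hy : Coalgebra.comul (R := ℂ) y = ∑ q, b q ⊗ₜ[ℂ] b' q) :
    applySnd φ (x * y) = ∑ p, ∑ q, φ (a' p * b' q) • (a p * b q) := by
  simp [applySnd, Bialgebra.comul_mul, hx, hy, Finset.sum_mul_sum]

theorem applyFst_mul_of_comul_eq {A ι κ : Type*} [Ring A] [Bialgebra ℂ A] [Fintype ι] [Fintype κ]
    (φ : A →ₗ[ℂ] ℂ) {x y : A} {a a' : ι → A} {b b' : κ → A}
    (hx : Coalgebra.comul (R := ℂ) x = ∑ p, a p ⊗ₜ[ℂ] a' p)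
    (hy : Coalgebra.comul (R := ℂ) y = ∑ q, b q ⊗ₜ[ℂ] b' q) :
    applyFst φ (x * y) = ∑ p, ∑ q, φ (a p * b q) • (a' p * b' q) := by
  simp [applyFst, Bialgebra.comul_mul, hx, hy, Finset.sum_mul_sum]

/-- If `u T v* = T` and `v* v = 1`, then `T` intertwines `u` and `v`. -/
theorem intertwines_of_conj_right {A : Type*} [Ring A] [StarRing A] [Algebra ℂ A] {m n : ℕ}
    {u : Matrix (Fin m) (Fin m) A} {v : Matrix (Fin n) (Fin n) A} (hv : IsUnitaryMatrix v)
    {T : Matrix (Fin m) (Fin n) ℂ}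
    (hT : ∀ i j, ∑ p, ∑ q, T p q • (u i p * star (v j q)) = T i j • (1 : A)) :
    Intertwines u v T := by
  intro i r
  calc ∑ p, T p r • u i p
      = ∑ p, ∑ q, T p q • (u i p * ∑ j, star (v j q) * v j r) := by simp [hv.2]
    _ = ∑ j, (∑ p, ∑ q, T p q • (u i p * star (v j q))) * v j r := by
        simp only [Finset.mul_sum, Finset.sum_mul, Finset.smul_sum, smul_mul_assoc, mul_assoc]
        exact Finset.sum_comm_cycle
    _ = ∑ j, T i j • v j r := by simp [hT]

/-- If `u* T v = T` and `u u* = 1`, then `T` intertwines `u` and `v`. -/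
theorem intertwines_of_conj_left {A : Type*} [Ring A] [StarRing A] [Algebra ℂ A] {m n : ℕ}
    {u : Matrix (Fin m) (Fin m) A} {v : Matrix (Fin n) (Fin n) A} (hu : IsUnitaryMatrix u)
    {T : Matrix (Fin m) (Fin n) ℂ}
    (hT : ∀ i j, ∑ p, ∑ q, T p q • (star (u p i) * v q j) = T i j • (1 : A)) :
    Intertwines u v T := by
  intro r j
  symm
  calc ∑ q, T r q • v q j
      = ∑ p, ∑ q, T p q • ((∑ i, u r i * star (u p i)) * v q j) := by
        simp [hu.1]
    _ = ∑ i, u r i * ∑ p, ∑ q, T p q • (star (u p i) * v q j) := by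
        simp only [Finset.mul_sum, Finset.sum_mul, Finset.smul_sum, mul_smul_comm, mul_assoc]
        exact Finset.sum_comm_cycle
    _ = ∑ i, T i j • u r i := by simp [hT]

/-- Orthogonality of matrix coefficients of inequivalent irreducible unitary corepresentations. -/
theorem orthogonality_of_inequivalent {A : Type*} [Ring A] [StarRing A] [HopfAlgebra ℂ A]
    [StarModule ℂ A] (hstar : ComulStar A)
    (h : A →ₗ[ℂ] ℂ) (hh : IsHaarState h)
    {m n : ℕ} {u : Matrix (Fin m) (Fin m) A} {v : Matrix (Fin n) (Fin n) A}
    (hu : IsCorep u) (huU : IsUnitaryMatrix u) (huirr : IsIrreducibleCorep u)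
    (hv : IsCorep v) (hvU : IsUnitaryMatrix v) (hvirr : IsIrreducibleCorep v)
    (hineq : ∀ T : Matrix (Fin m) (Fin n) ℂ, Intertwines u v T → T = 0)
    (hineq' : ∀ T : Matrix (Fin n) (Fin m) ℂ, Intertwines v u T → T = 0) :
    (∀ (m' k : Fin m) (n' l : Fin n), h (u m' k * star (v n' l)) = 0) ∧
      ∀ (k m' : Fin m) (l n' : Fin n), h (star (u k m') * v l n') = 0 := by
  obtain ⟨-, hsnd, hfst, -⟩ := hh
  refine ⟨fun i k j l => ?_, fun k i l j => ?_⟩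
  · refine congrFun₂ (hineq (Matrix.of fun i j => h (u i k * star (v j l)))
      (intertwines_of_conj_right hvU fun i j => ?_)) i j
    exact (applySnd_mul_of_comul_eq h (hu.1 i k) (hv.comul_star hstar j l)).symm.trans (hsnd _)
  · refine congrFun₂ (hineq (Matrix.of fun i j => h (star (u k i) * v l j))
      (intertwines_of_conj_left huU fun i j => ?_)) i j
    exact (applyFst_mul_of_comul_eq h (hu.comul_star hstar k i) (hv.1 l j)).symm.trans (hfst _)
end

section
/- Let h be a faithful Haar state on A and let u ∈ M_d(A) be an irreducible unitary corepresentation. Then there exists a unique positive definite invertible matrix F ∈ M_d(ℂ) with Tr(F) = Tr(F⁻¹) =: M such that for all k, l, m, n ∈ {1,…,d}: (1) h(u_{mk}·star(u_{nl})) = δ_{mn}·F_{lk}/M; (2) h(star(u_{km})·u_{ln}) = δ_{mn}·(F⁻¹)_{lk}/M; and (3) S(S(u_{ij})) = Σ_{k,l} F_{ik}·u_{kl}·(F⁻¹)_{lj} for all i, j (i.e. the square of the antipode acts on the coefficients of u by conjugation with F). -/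
open scoped TensorProduct BigOperators ComplexOrder

section Invariance

variable {A : Type*} [Ring A]

theorem applySnd_of_comul_eq [Bialgebra ℂ A] (φ : A →ₗ[ℂ] ℂ) {m n : Type*} [Fintype m]
    [Fintype n] {a : A} {x y : m → n → A}
    (ha : Coalgebra.comul (R := ℂ) a = ∑ i, ∑ j, x i j ⊗ₜ[ℂ] y i j) :
    applySnd φ a = ∑ i, ∑ j, φ (y i j) • x i j := by
  simp [applySnd, ha]

theorem applyFst_of_comul_eq [Bialgebra ℂ A] (φ : A →ₗ[ℂ] ℂ) {m n : Type*} [Fintype m]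
    [Fintype n] {a : A} {x y : m → n → A}
    (ha : Coalgebra.comul (R := ℂ) a = ∑ i, ∑ j, x i j ⊗ₜ[ℂ] y i j) :
    applyFst φ a = ∑ i, ∑ j, φ (x i j) • y i j := by
  simp [applyFst, ha]

variable {d : ℕ} {u v : Matrix (Fin d) (Fin d) A}

theorem IsCorep.comul_mul [Bialgebra ℂ A] (hu : IsCorep u) (hv : IsCorep v) (i j k l : Fin d) :
    Coalgebra.comul (R := ℂ) (u i j * v k l) =
      ∑ a, ∑ b, (u i a * v k b) ⊗ₜ[ℂ] (u a j * v b l) := by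
  rw [Bialgebra.comul_mul, hu.1, hv.1, Finset.sum_mul_sum]
  simp only [Algebra.TensorProduct.tmul_mul_tmul]

theorem IsCorep.mul_map_haar_mul_transpose [StarRing A] [Bialgebra ℂ A] {h : A →ₗ[ℂ] ℂ}
    (hh : IsHaarState h) (hu : IsCorep u) (hv : IsCorep v) (j l : Fin d) :
    u * (Matrix.of fun a b => h (u a j * v b l)).map (algebraMap ℂ A) * v.transpose =
      (Matrix.of fun a b => h (u a j * v b l)).map (algebraMap ℂ A) := by
  ext i k
  have key := hh.2.1 (u i j * v k l)
  rw [applySnd_of_comul_eq h (hu.comul_mul hv i j k l)] at key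
  simp only [Matrix.mul_apply, Matrix.map_apply, Matrix.of_apply, Matrix.transpose_apply,
    Finset.sum_mul]
  rw [Algebra.algebraMap_eq_smul_one, ← key, Finset.sum_comm]
  refine Finset.sum_congr rfl fun a _ => Finset.sum_congr rfl fun b _ => ?_
  rw [← Algebra.commutes, ← Algebra.smul_def, smul_mul_assoc]

theorem IsCorep.transpose_mul_map_haar_mul [StarRing A] [Bialgebra ℂ A] {h : A →ₗ[ℂ] ℂ}
    (hh : IsHaarState h) (hu : IsCorep u) (hv : IsCorep v) (i k : Fin d) :
    u.transpose * (Matrix.of fun a b => h (u i a * v k b)).map (algebraMap ℂ A) * v =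
      (Matrix.of fun a b => h (u i a * v k b)).map (algebraMap ℂ A) := by
  ext j l
  have key := hh.2.2.1 (u i j * v k l)
  rw [applyFst_of_comul_eq h (hu.comul_mul hv i j k l)] at key
  simp only [Matrix.mul_apply, Matrix.map_apply, Matrix.of_apply, Matrix.transpose_apply,
    Finset.sum_mul]
  rw [Algebra.algebraMap_eq_smul_one, ← key, Finset.sum_comm]
  refine Finset.sum_congr rfl fun a _ => Finset.sum_congr rfl fun b _ => ?_
  rw [← Algebra.commutes, ← Algebra.smul_def, smul_mul_assoc]

theorem IsCorep.map_antipode_mul [HopfAlgebra ℂ A] (hu : IsCorep u) :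
    u.map (HopfAlgebra.antipode (R := ℂ)) * u = 1 := by
  ext i j
  have key := HopfAlgebra.mul_antipode_rTensor_comul_apply (R := ℂ) (u i j)
  rw [hu.1, hu.2] at key
  simp only [map_sum, LinearMap.rTensor_tmul, LinearMap.mul'_apply] at key
  simp only [Matrix.mul_apply, Matrix.map_apply, key, Matrix.one_apply]
  split_ifs <;> simp

theorem IsCorep.mul_map_antipode [HopfAlgebra ℂ A] (hu : IsCorep u) :
    u * u.map (HopfAlgebra.antipode (R := ℂ)) = 1 := by
  ext i j
  have key := HopfAlgebra.mul_antipode_lTensor_comul_apply (R := ℂ) (u i j)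
  rw [hu.1, hu.2] at key
  simp only [map_sum, LinearMap.lTensor_tmul, LinearMap.mul'_apply] at key
  simp only [Matrix.mul_apply, Matrix.map_apply, key, Matrix.one_apply]
  split_ifs <;> simp

theorem intertwines_iff_map [Algebra ℂ A] {T : Matrix (Fin d) (Fin d) ℂ} :
    Intertwines u v T ↔ u * T.map (algebraMap ℂ A) = T.map (algebraMap ℂ A) * v := by
  simp only [Intertwines, ← Matrix.ext_iff, Matrix.mul_apply, Matrix.map_apply,
    Algebra.smul_def, Algebra.commutes]

theorem intertwines_transpose_of_map [Algebra ℂ A] {T : Matrix (Fin d) (Fin d) ℂ}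
    (hT : T.map (algebraMap ℂ A) * u.transpose = v.transpose * T.map (algebraMap ℂ A)) :
    Intertwines u v T.transpose := by
  intro i j
  have key := congrFun₂ hT j i
  simp only [Matrix.mul_apply, Matrix.map_apply, Matrix.transpose_apply] at key
  simpa only [Matrix.transpose_apply, Algebra.smul_def, Algebra.commutes] using key

theorem IsUnitaryMatrix.mul_conjTranspose [StarRing A] (hu : IsUnitaryMatrix u) :
    u * u.conjTranspose = 1 := by
  ext i j
  simpa [Matrix.mul_apply, Matrix.one_apply] using hu.1 i j

theorem IsUnitaryMatrix.conjTranspose_mul [StarRing A] (hu : IsUnitaryMatrix u) :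
    u.conjTranspose * u = 1 := by
  ext i j
  simpa [Matrix.mul_apply, Matrix.one_apply] using hu.2 i j

theorem IsCorep.map_star [StarRing A] [Bialgebra ℂ A] (hstar : ComulStar A) (hu : IsCorep u)
    (huU : IsUnitaryMatrix u) : IsCorep (u.map star) := by
  refine ⟨fun i j => hstar _ d _ _ (hu.1 i j), fun i j => ?_⟩
  have key := congrArg (Coalgebra.counit (R := ℂ)) (huU.1 j i)
  simp only [map_sum, Bialgebra.counit_mul, hu.2, ite_mul, one_mul, zero_mul,
    Finset.sum_ite_eq, Finset.mem_univ, if_true] at key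
  rw [Matrix.map_apply, key]
  by_cases hij : i = j
  · simp [hij]
  · simp [hij, Ne.symm hij]

theorem IsCorep.antipode_eq_star [StarRing A] [HopfAlgebra ℂ A] (hu : IsCorep u)
    (huU : IsUnitaryMatrix u) (i j : Fin d) :
    HopfAlgebra.antipode (R := ℂ) (u i j) = star (u j i) :=
  Matrix.ext_iff.mpr (left_inv_eq_right_inv hu.map_antipode_mul huU.mul_conjTranspose) i j

end Invariance

section Orthogonality

variable {A : Type*} [Ring A] [StarRing A] [Bialgebra ℂ A] {h : A →ₗ[ℂ] ℂ} {d : ℕ}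
  {u : Matrix (Fin d) (Fin d) A}

theorem exists_haar_mul_star_eq (hstar : ComulStar A) (hh : IsHaarState h)
    (hu : IsCorep u) (huU : IsUnitaryMatrix u) (huirr : IsIrreducibleCorep u) :
    ∃ C : Matrix (Fin d) (Fin d) ℂ, ∀ k l m n,
      h (u m k * star (u n l)) = if m = n then C k l else 0 := by
  have key : ∀ k l, ∃ c : ℂ,
      (Matrix.of fun a b => h (u a k * star (u b l))) = c • (1 : Matrix (Fin d) (Fin d) ℂ) := by
    intro k l
    refine huirr _ (intertwines_iff_map.mpr ?_)
    have e := hu.mul_map_haar_mul_transpose hh (hu.map_star hstar huU) k l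
    have e' := congrArg (· * u) e
    rw [show (u.map star).transpose = u.conjTranspose from rfl] at e'
    simpa [mul_assoc, huU.conjTranspose_mul] using e'
  choose C hC using key
  refine ⟨C, fun k l m n => ?_⟩
  simpa [Matrix.one_apply] using congrFun₂ (hC k l) m n

theorem exists_haar_star_mul_eq (hstar : ComulStar A) (hh : IsHaarState h)
    (hu : IsCorep u) (huU : IsUnitaryMatrix u) (huirr : IsIrreducibleCorep u) :
    ∃ C : Matrix (Fin d) (Fin d) ℂ, ∀ k l m n,
      h (star (u k m) * u l n) = if m = n then C k l else 0 := by
  have key : ∀ k l, ∃ c : ℂ,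
      (Matrix.of fun a b => h (star (u k a) * u l b)) = c • (1 : Matrix (Fin d) (Fin d) ℂ) := by
    intro k l
    refine huirr _ (intertwines_iff_map.mpr ?_)
    have e := (hu.map_star hstar huU).transpose_mul_map_haar_mul hh hu k l
    have e' := congrArg (u * ·) e
    rw [show (u.map star).transpose = u.conjTranspose from rfl] at e'
    simpa [← mul_assoc, huU.mul_conjTranspose] using e'.symm
  choose C hC using key
  refine ⟨C, fun k l m n => ?_⟩
  simpa [Matrix.one_apply] using congrFun₂ (hC k l) m n

/-- A complex matrix with positive quadratic form is positive definite: hermiticity is automatic. -/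
theorem Matrix.posDef_of_forall_dotProduct_mulVec_pos {n : Type*} [Fintype n] [DecidableEq n]
    {C : Matrix n n ℂ} (hC : ∀ x : n → ℂ, x ≠ 0 → 0 < star x ⬝ᵥ (C.mulVec x)) : C.PosDef := by
  refine Matrix.posDef_iff_dotProduct_mulVec.mpr ⟨?_, hC⟩
  rw [← Matrix.isSymmetric_toEuclideanLin_iff, LinearMap.isSymmetric_iff_inner_map_self_real]
  intro x
  have hx : 0 ≤ star x.ofLp ⬝ᵥ (C.mulVec x.ofLp) := by
    rcases eq_or_ne x.ofLp 0 with hx | hx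
    · simp [hx]
    · exact (hC _ hx).le
  have hreal : star (star x.ofLp ⬝ᵥ (C.mulVec x.ofLp)) = star x.ofLp ⬝ᵥ (C.mulVec x.ofLp) :=
    (IsSelfAdjoint.of_nonneg hx).star_eq
  rw [inner_conj_symm, ← inner_conj_symm (C.toEuclideanLin x) x,
    EuclideanSpace.inner_eq_star_dotProduct, dotProduct_comm]
  exact hreal.symm

/-- The Gram matrix, for a faithful positive functional, of the columns of a matrix `v` with
`ε(vᵢⱼ) = δᵢⱼ` is positive definite if it does not depend on the column. -/
theorem posDef_of_gram [StarModule ℂ A] (hpos : ∀ a : A, 0 ≤ h (star a * a))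
    (hfaith : ∀ a : A, h (star a * a) = 0 → a = 0) {v : Matrix (Fin d) (Fin d) A}
    (hv : ∀ i j, Coalgebra.counit (R := ℂ) (v i j) = if i = j then 1 else 0)
    {C : Matrix (Fin d) (Fin d) ℂ} (hC : ∀ k l j, h (star (v k j) * v l j) = C k l) :
    C.PosDef := by
  have quad : ∀ (x : Fin d → ℂ) (j : Fin d), star x ⬝ᵥ (C.mulVec x) =
      h (star (∑ i, x i • v i j) * ∑ i, x i • v i j) := by
    intro x j
    rw [star_sum, Finset.sum_mul_sum]
    simp only [star_smul, map_sum, smul_mul_smul_comm, map_smul, hC, dotProduct, Matrix.mulVec,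
      Finset.mul_sum, Pi.star_apply, smul_eq_mul]
    exact Finset.sum_congr rfl fun a _ => Finset.sum_congr rfl fun b _ => by ring
  refine Matrix.posDef_of_forall_dotProduct_mulVec_pos fun x hx => ?_
  obtain ⟨j, hj⟩ : ∃ j, ∑ i, x i • v i j ≠ 0 := by
    by_contra! hc
    refine hx (funext fun j => ?_)
    simpa [hv] using congrArg (Coalgebra.counit (R := ℂ)) (hc j)
  rw [quad x j]
  exact lt_of_le_of_ne (hpos _) fun e => hj (hfaith _ e.symm)

end Orthogonality

/-- If `C` is positive definite, `D` has trace one and `C * D` is a scalar, then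
`D = M⁻² • C⁻¹` where `M > 0` is the square root of the trace of `C⁻¹`. -/
theorem exists_balanced_scaling {d : ℕ} [NeZero d] {C D : Matrix (Fin d) (Fin d) ℂ}
    (hC : C.PosDef) (hDt : D.trace = 1) {c : ℂ} (hCD : C * D = c • 1) :
    ∃ M : ℂ, 0 < M ∧ C⁻¹.trace = M * M ∧ D = (M * M)⁻¹ • C⁻¹ := by
  have hpos : 0 < C⁻¹.trace := hC.inv.trace_pos
  have hdet : IsUnit C.det := (Matrix.isUnit_iff_isUnit_det _).mp hC.isUnit
  have hD : D = c • C⁻¹ := by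
    rw [← Matrix.nonsing_inv_mul_cancel_left C D hdet, hCD, Matrix.mul_smul, mul_one]
  have hc : c * C⁻¹.trace = 1 := by
    rw [← hDt, hD, Matrix.trace_smul, smul_eq_mul]
  obtain ⟨hre, him⟩ := Complex.pos_iff.mp hpos
  have hsq : C⁻¹.trace = (√(C⁻¹.trace.re) : ℂ) * (√(C⁻¹.trace.re) : ℂ) := by
    rw [← Complex.ofReal_mul, Real.mul_self_sqrt hre.le]
    exact Complex.ext rfl (by simpa using him.symm)
  refine ⟨(√(C⁻¹.trace.re) : ℂ), by exact_mod_cast Real.sqrt_pos.mpr hre, hsq, ?_⟩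
  rw [← hsq, hD, eq_inv_of_mul_eq_one_left hc]

theorem Matrix.PosDef.eq_of_trace_eq_trace_inv {d : ℕ} {F G : Matrix (Fin d) (Fin d) ℂ}
    (hF : F.PosDef) (hG : G.PosDef) (hFt : F.trace = F⁻¹.trace) (hGt : G.trace = G⁻¹.trace)
    (hFG : ∀ k l, F l k / F.trace = G l k / G.trace) : F = G := by
  rcases Nat.eq_zero_or_pos d with rfl | hd
  · exact Subsingleton.elim _ _
  have : NeZero d := ⟨hd.ne'⟩
  have hf : 0 < F.trace := hF.trace_pos
  have hg : 0 < G.trace := hG.trace_pos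
  have hf0 := hf.ne'
  have hg0 := hg.ne'
  have hFe : F = (F.trace / G.trace) • G := by
    ext l k
    have := hFG k l
    simp only [Matrix.smul_apply, smul_eq_mul]
    field_simp at this ⊢
    linear_combination this
  have hinv : F⁻¹ = (G.trace / F.trace) • G⁻¹ := by
    refine Matrix.inv_eq_right_inv ?_
    conv_lhs => rw [hFe]
    rw [Matrix.smul_mul, Matrix.mul_smul,
      Matrix.mul_nonsing_inv _ ((Matrix.isUnit_iff_isUnit_det _).mp hG.isUnit), smul_smul]
    rw [← hFe, div_mul_div_cancel₀ hg0, div_self hf0, one_smul]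
  have hsq : F.trace * F.trace = G.trace * G.trace := by
    have := congrArg Matrix.trace hinv
    rw [Matrix.trace_smul, ← hFt, ← hGt, smul_eq_mul] at this
    field_simp at this
    linear_combination this
  have heq : F.trace = G.trace := by
    rcases mul_self_eq_mul_self_iff.mp hsq with e | e
    · exact e
    · exact absurd ((e ▸ hf).trans (neg_lt_zero.mpr hg)) (lt_irrefl _)
  rw [hFe, heq, div_self hg0, one_smul]

/-- Existence and uniqueness of the Woronowicz `F`-matrix of an irreducible unitary
corepresentation, together with the Schur orthogonality relations and the action of the square
of the antipode. -/
theorem exists_unique_F_matrix {A : Type*} [Ring A] [StarRing A] [HopfAlgebra ℂ A]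
    [StarModule ℂ A] (hstar : ComulStar A)
    (h : A →ₗ[ℂ] ℂ) (hh : IsHaarState h) (hfaith : ∀ a : A, h (star a * a) = 0 → a = 0)
    {d : ℕ} {u : Matrix (Fin d) (Fin d) A}
    (hu : IsCorep u) (huU : IsUnitaryMatrix u) (huirr : IsIrreducibleCorep u) :
    ∃! F : Matrix (Fin d) (Fin d) ℂ, F.PosDef ∧ IsUnit F ∧ F.trace = F⁻¹.trace ∧
      (∀ k l m' n' : Fin d,
        h (u m' k * star (u n' l)) = if m' = n' then F l k / F.trace else 0) ∧
      (∀ k l m' n' : Fin d,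
        h (star (u k m') * u l n') = if m' = n' then F⁻¹ l k / F.trace else 0) ∧
      ∀ i j : Fin d,
        HopfAlgebra.antipode (R := ℂ) (HopfAlgebra.antipode (R := ℂ) (u i j)) =
          ∑ k, ∑ l, (F i k * F⁻¹ l j) • u k l := by
  have uniq : ∀ F G : Matrix (Fin d) (Fin d) ℂ, F.PosDef → G.PosDef →
      F.trace = F⁻¹.trace → G.trace = G⁻¹.trace →
      (∀ k l m' n' : Fin d,
        h (u m' k * star (u n' l)) = if m' = n' then F l k / F.trace else 0) →
      (∀ k l m' n' : Fin d,
        h (u m' k * star (u n' l)) = if m' = n' then G l k / G.trace else 0) → F = G := by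
    intro F G hF hG hFt hGt h₁ h₂
    refine hF.eq_of_trace_eq_trace_inv hG hFt hGt fun k l => ?_
    simpa using (h₁ k l k k).symm.trans (h₂ k l k k)
  refine existsUnique_of_exists_of_unique ?_ fun F G hF hG =>
    uniq F G hF.1 hG.1 hF.2.2.1 hG.2.2.1 hF.2.2.2.1 hG.2.2.2.1
  rcases Nat.eq_zero_or_pos d with rfl | hd
  · exact ⟨1, Matrix.PosDef.one, isUnit_one, by simp, fun k => k.elim0, fun k => k.elim0,
      fun k => k.elim0⟩
  have : NeZero d := ⟨hd.ne'⟩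
  obtain ⟨C, hC⟩ := exists_haar_mul_star_eq hstar hh hu huU huirr
  obtain ⟨D, hD⟩ := exists_haar_star_mul_eq hstar hh hu huU huirr
  have hv := hu.map_star hstar huU
  have hCpos : C.PosDef :=
    posDef_of_gram hh.2.2.2 hfaith (v := u.conjTranspose)
      (fun i j => (hv.2 j i).trans (by simp only [eq_comm]))
      (fun k l j => by simp [hC])
  have hCt : C.trace = 1 := by
    have key := congrArg h (huU.1 0 0)
    simpa [hC, hh.1, Matrix.trace] using key
  have hDt : D.trace = 1 := by
    have key := congrArg h (huU.2 0 0)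
    simpa [hD, hh.1, Matrix.trace] using key
  set s := (u.map star).map (HopfAlgebra.antipode (R := ℂ)) with hs
  have hCu : u.transpose * C.map (algebraMap ℂ A) = C.map (algebraMap ℂ A) * s := by
    have e := hu.transpose_mul_map_haar_mul hh hv 0 0
    rw [show (Matrix.of fun a b => h (u 0 a * (u.map star) 0 b)) = C by ext; simp [hC]] at e
    rw [← congrArg (· * s) e]
    simp only [mul_assoc, hs, hv.mul_map_antipode, mul_one]
  have hDu : D.map (algebraMap ℂ A) * u.transpose = s * D.map (algebraMap ℂ A) := by
    have e := hv.mul_map_haar_mul_transpose hh hu 0 0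
    rw [show (Matrix.of fun a b => h ((u.map star) a 0 * u b 0)) = D by ext; simp [hD]] at e
    rw [← congrArg (s * ·) e]
    simp only [← mul_assoc, hs, hv.map_antipode_mul, one_mul]
  obtain ⟨c, hCD⟩ : ∃ c : ℂ, C * D = c • 1 := by
    have key : (C * D).map (algebraMap ℂ A) * u.transpose =
        u.transpose * (C * D).map (algebraMap ℂ A) := by
      rw [Matrix.map_mul, mul_assoc, hDu, ← mul_assoc, ← hCu, mul_assoc]
    obtain ⟨c, hc⟩ := huirr _ (intertwines_transpose_of_map key)
    exact ⟨c, by simpa using congrArg Matrix.transpose hc⟩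
  obtain ⟨M, hM, hMt, hDC⟩ := exists_balanced_scaling hCpos hDt hCD
  have hM0 := hM.ne'
  have hdet : IsUnit C.det := (Matrix.isUnit_iff_isUnit_det _).mp hCpos.isUnit
  have hFpos : (M • C.transpose).PosDef := hCpos.transpose.smul hM
  have hFinv : (M • C.transpose)⁻¹ = M⁻¹ • C⁻¹.transpose := by
    refine Matrix.inv_eq_right_inv ?_
    rw [Matrix.smul_mul, Matrix.mul_smul, ← Matrix.transpose_mul,
      Matrix.nonsing_inv_mul _ hdet, smul_smul, mul_inv_cancel₀ hM0]
    simp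
  have hFt : (M • C.transpose).trace = M := by simp [hCt]
  refine ⟨M • C.transpose, hFpos, hFpos.isUnit, ?_, ?_, ?_, ?_⟩
  · rw [hFinv, hFt, Matrix.trace_smul, Matrix.trace_transpose, hMt, smul_eq_mul,
      inv_mul_cancel_left₀ hM0]
  · intro k l m' n'
    rw [hFt, hC]
    simp [hM0]
  · intro k l m' n'
    rw [hFt, hD, hFinv, hDC]
    simp [div_eq_mul_inv, mul_comm, mul_assoc]
  · intro i j
    rw [hFinv, hu.antipode_eq_star huU]
    have hs' : s = C⁻¹.map (algebraMap ℂ A) * (u.transpose * C.map (algebraMap ℂ A)) := by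
      rw [hCu, ← mul_assoc, ← Matrix.map_mul, Matrix.nonsing_inv_mul _ hdet]
      simp
    have key := congrFun₂ hs' j i
    rw [hs] at key
    simp only [Matrix.map_apply] at key
    rw [key]
    simp only [Matrix.mul_apply, Matrix.map_apply, Matrix.transpose_apply, Matrix.smul_apply,
      smul_eq_mul, Finset.mul_sum]
    rw [Finset.sum_comm]
    refine Finset.sum_congr rfl fun a _ => Finset.sum_congr rfl fun b _ => ?_
    rw [← Algebra.commutes, ← mul_assoc, ← map_mul, ← Algebra.smul_def]
    congr 1
    field_simp
end

section
/- Let h be a faithful Haar state on A and let v ∈ M_d(A) be a corepresentation (Δ(v_{ij}) = Σ_k v_{ik} ⊗ v_{kj} and ε(v_{ij}) = δ_{ij}) that is invertible as an element of the matrix ring M_d(A). Then there exists a positive definite invertible matrix Q ∈ M_d(ℂ) such that Q·v·Q⁻¹ ∈ M_d(A) is a unitary corepresentation of A; that is, v is equivalent to a unitary corepresentation. -/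
open scoped TensorProduct BigOperators ComplexOrder

theorem applyFst_eq_sum {A ι : Type*} [Ring A] [Bialgebra ℂ A] [Fintype ι] (φ : A →ₗ[ℂ] ℂ)
    {x : A} {a b : ι → A} (hx : Coalgebra.comul (R := ℂ) x = ∑ i, a i ⊗ₜ[ℂ] b i) :
    applyFst φ x = ∑ i, φ (a i) • b i := by
  simp [applyFst, hx]

theorem IsHaarState.map_star {A : Type*} [Ring A] [StarRing A] [Bialgebra ℂ A] [StarModule ℂ A]
    {h : A →ₗ[ℂ] ℂ} (hh : IsHaarState h) (a : A) : h (star a) = star (h a) := by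
  have him (x : A) : (h (star x * x)).im = 0 := (Complex.nonneg_iff.mp (hh.2.2.2 x)).2.symm
  have h₁ := him (1 + a)
  have h₂ := him (1 + Complex.I • a)
  have h₃ := him a
  simp only [star_add, star_one, star_smul, add_mul, mul_add, one_mul, mul_one, smul_mul_assoc,
    mul_smul_comm, map_add, map_smul, hh.1, smul_eq_mul] at h₁ h₂
  simp at h₁ h₂
  rw [h₃] at h₁ h₂
  apply Complex.ext <;> simp <;> linarith

/-- The scalar matrix `(h ⊗ id)(v* v)` obtained by averaging the standard inner product. -/
noncomputable def averagedGram {A : Type*} [Ring A] [StarRing A] [Algebra ℂ A] {d : ℕ}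
    (h : A →ₗ[ℂ] ℂ) (v : Matrix (Fin d) (Fin d) A) : Matrix (Fin d) (Fin d) ℂ :=
  (v.conjTranspose * v).map h

theorem averagedGram_apply {A : Type*} [Ring A] [StarRing A] [Algebra ℂ A] {d : ℕ}
    (h : A →ₗ[ℂ] ℂ) (v : Matrix (Fin d) (Fin d) A) (i j : Fin d) :
    averagedGram h v i j = ∑ k, h (star (v k i) * v k j) := by
  simp [averagedGram, Matrix.mul_apply]

theorem conjTranspose_mul_averagedGram_mul {A : Type*} [Ring A] [StarRing A] [Bialgebra ℂ A]
    (hstar : ComulStar A) {h : A →ₗ[ℂ] ℂ} (hh : IsHaarState h) {d : ℕ}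
    {v : Matrix (Fin d) (Fin d) A} (hv : IsCorep v) :
    v.conjTranspose * (averagedGram h v).map (algebraMap ℂ A) * v =
      (averagedGram h v).map (algebraMap ℂ A) := by
  ext i j
  have hΔ : Coalgebra.comul (R := ℂ) ((v.conjTranspose * v) i j) =
      ∑ p : Fin d × Fin d × Fin d, (star (v p.1 p.2.1) * v p.1 p.2.2) ⊗ₜ[ℂ]
        (star (v p.2.1 i) * v p.2.2 j) := by
    simp only [Matrix.mul_apply, Matrix.conjTranspose_apply, map_sum, Bialgebra.comul_mul,
      hv.1, hstar _ _ _ _ (hv.1 _ _), Finset.sum_mul_sum, Algebra.TensorProduct.tmul_mul_tmul,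
      Fintype.sum_prod_type]
  have hinv := hh.2.2.1 ((v.conjTranspose * v) i j)
  rw [applyFst_eq_sum h hΔ] at hinv
  rw [Matrix.map_apply, Algebra.algebraMap_eq_smul_one]
  refine Eq.trans ?_ hinv
  simp only [Matrix.mul_apply, Matrix.conjTranspose_apply, Matrix.map_apply, averagedGram_apply,
    Fintype.sum_prod_type, map_sum, Finset.mul_sum, Finset.sum_mul]
  calc _ = ∑ m, ∑ k, ∑ l, h (star (v k l) * v k m) • (star (v l i) * v m j) := by
        refine Finset.sum_congr rfl fun m _ ↦ ?_
        rw [Finset.sum_comm]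
        refine Finset.sum_congr rfl fun k _ ↦ Finset.sum_congr rfl fun l _ ↦ ?_
        rw [← Algebra.commutes, mul_assoc, ← Algebra.smul_def]
    _ = _ := by
        rw [Finset.sum_comm]
        exact Finset.sum_congr rfl fun k _ ↦ Finset.sum_comm

theorem averagedGram_posDef {A : Type*} [Ring A] [StarRing A] [Bialgebra ℂ A] [StarModule ℂ A]
    {h : A →ₗ[ℂ] ℂ} (hh : IsHaarState h) (hfaith : ∀ a : A, h (star a * a) = 0 → a = 0) {d : ℕ}
    {v : Matrix (Fin d) (Fin d) A} (hv : IsCorep v) : (averagedGram h v).PosDef := by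
  refine Matrix.PosDef.of_dotProduct_mulVec_pos ?_ fun x hx ↦ ?_
  · ext i j
    simp [averagedGram_apply, ← hh.map_star]
  · let w (k : Fin d) : A := ∑ j, x j • v k j
    have hw (k : Fin d) : Coalgebra.counit (R := ℂ) (w k) = x k := by
      simp [w, hv.2]
    have hsum : star x ⬝ᵥ (averagedGram h v).mulVec x = ∑ k, h (star (w k) * w k) := by
      simp only [w, dotProduct, Matrix.mulVec, averagedGram_apply, Pi.star_apply, star_sum,
        star_smul, smul_mul_smul_comm, map_sum, map_smul, smul_eq_mul,
        Finset.mul_sum, Finset.sum_mul]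
      calc _ = ∑ i, ∑ k, ∑ j, star (x i) * (h (star (v k i) * v k j) * x j) :=
            Finset.sum_congr rfl fun i _ ↦ Finset.sum_comm
        _ = _ := by
          rw [Finset.sum_comm]
          refine Finset.sum_congr rfl fun k _ ↦ ?_
          rw [Finset.sum_comm]
          exact Finset.sum_congr rfl fun j _ ↦ Finset.sum_congr rfl fun i _ ↦ by ring
    rw [hsum]
    obtain ⟨k, hk⟩ := Function.ne_iff.mp hx
    refine Finset.sum_pos' (fun k _ ↦ hh.2.2.2 (w k)) ⟨k, Finset.mem_univ k, ?_⟩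
    refine lt_of_le_of_ne (hh.2.2.2 (w k)) fun h₀ ↦ hk ?_
    rw [← hw k, hfaith _ h₀.symm, map_zero, Pi.zero_apply]

theorem isCorep_conj {A : Type*} [Ring A] [Bialgebra ℂ A] {d : ℕ}
    {v : Matrix (Fin d) (Fin d) A} (hv : IsCorep v) {Q R : Matrix (Fin d) (Fin d) ℂ}
    (hQR : Q * R = 1) (hRQ : R * Q = 1) :
    IsCorep (Q.map (algebraMap ℂ A) * v * R.map (algebraMap ℂ A)) := by
  have hentry (i j : Fin d) : (Q.map (algebraMap ℂ A) * v * R.map (algebraMap ℂ A)) i j =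
      ∑ l, ∑ k, (Q i k * R l j) • v k l := by
    simp only [Matrix.mul_apply, Matrix.map_apply, Finset.sum_mul]
    refine Finset.sum_congr rfl fun l _ ↦ Finset.sum_congr rfl fun k _ ↦ ?_
    rw [← Algebra.commutes, ← mul_assoc, ← map_mul, mul_comm (R l j), ← Algebra.smul_def]
  refine ⟨fun i j ↦ ?_, fun i j ↦ ?_⟩
  · have hRQ' (a b : Fin d) : ∑ k, R a k * Q k b = if a = b then 1 else 0 := by
      rw [← Matrix.mul_apply, hRQ, Matrix.one_apply]
    calc _ = ∑ l, ∑ k, ∑ a, (Q i k * R l j) • v k a ⊗ₜ[ℂ] v a l := by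
          simp only [hentry, map_sum, map_smul, hv.1, Finset.smul_sum]
      _ = ∑ l, ∑ k, ∑ a, ∑ b, ((∑ m, R a m * Q m b) * (Q i k * R l j)) •
            v k a ⊗ₜ[ℂ] v b l := by
          simp [hRQ', ite_smul]
      _ = ∑ p : Fin d × Fin d × Fin d × Fin d × Fin d,
            (R p.2.2.1 p.2.2.2.2 * Q p.2.2.2.2 p.2.2.2.1 * (Q i p.2.1 * R p.1 j)) •
            v p.2.1 p.2.2.1 ⊗ₜ[ℂ] v p.2.2.2.1 p.1 := by
          simp only [Fintype.sum_prod_type, Finset.sum_mul, Finset.sum_smul]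
      _ = ∑ p : Fin d × Fin d × Fin d × Fin d × Fin d,
            ((Q i p.2.2.2.2 * R p.2.2.2.1 p.1) * (Q p.1 p.2.2.1 * R p.2.1 j)) •
            v p.2.2.2.2 p.2.2.2.1 ⊗ₜ[ℂ] v p.2.2.1 p.2.1 :=
          Fintype.sum_equiv
            ⟨fun p ↦ (p.2.2.2.2, p.1, p.2.2.2.1, p.2.2.1, p.2.1),
              fun p ↦ (p.2.1, p.2.2.2.2, p.2.2.2.1, p.2.2.1, p.1), fun _ ↦ rfl, fun _ ↦ rfl⟩
            _ _ fun _ ↦ by dsimp only [Equiv.coe_fn_mk]; congr 1; ring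
      _ = _ := by
          simp only [Fintype.sum_prod_type, hentry, TensorProduct.sum_tmul,
            TensorProduct.tmul_sum, TensorProduct.smul_tmul_smul]
  · have hQR' : ∑ k, Q i k * R k j = if i = j then 1 else 0 := by
      rw [← Matrix.mul_apply, hQR, Matrix.one_apply]
    rw [hentry, ← hQR']
    simp [hv.2]

theorem isUnitaryMatrix_iff {A : Type*} [Ring A] [StarRing A] {d : ℕ}
    {u : Matrix (Fin d) (Fin d) A} :
    IsUnitaryMatrix u ↔ u * u.conjTranspose = 1 ∧ u.conjTranspose * u = 1 := by
  simp [IsUnitaryMatrix, ← Matrix.ext_iff, Matrix.mul_apply, Matrix.one_apply]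

theorem Matrix.PosDef.exists_posDef_mul_self {n : Type*} [Fintype n] [DecidableEq n]
    {P : Matrix n n ℂ} (hP : P.PosDef) : ∃ Q : Matrix n n ℂ, Q.PosDef ∧ Q * Q = P := by
  open scoped MatrixOrder Matrix.Norms.L2Operator in
  exact ⟨CFC.sqrt P,
    Matrix.isStrictlyPositive_iff_posDef.mp (IsStrictlyPositive.sqrt P hP.isStrictlyPositive),
    CFC.sqrt_mul_sqrt_self P hP.posSemidef.nonneg⟩

/-- Every invertible corepresentation of a Hopf `*`-algebra with faithful Haar state is
equivalent, via conjugation by a positive definite invertible scalar matrix, to a unitary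
corepresentation. -/
theorem corep_equivalent_unitary {A : Type*} [Ring A] [StarRing A] [HopfAlgebra ℂ A]
    [StarModule ℂ A] (hstar : ComulStar A)
    (h : A →ₗ[ℂ] ℂ) (hh : IsHaarState h) (hfaith : ∀ a : A, h (star a * a) = 0 → a = 0)
    {d : ℕ} {v : Matrix (Fin d) (Fin d) A}
    (hv : IsCorep v) (hvinv : IsUnit v) :
    ∃ Q : Matrix (Fin d) (Fin d) ℂ, Q.PosDef ∧ IsUnit Q ∧
      IsCorep (Q.map (algebraMap ℂ A) * v * (Q⁻¹).map (algebraMap ℂ A)) ∧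
      IsUnitaryMatrix (Q.map (algebraMap ℂ A) * v * (Q⁻¹).map (algebraMap ℂ A)) := by
  obtain ⟨Q, hQ, hQP⟩ := (averagedGram_posDef hh hfaith hv).exists_posDef_mul_self
  have hdet : IsUnit Q.det := (Matrix.isUnit_iff_isUnit_det Q).mp hQ.isUnit
  have hQQ : Q * Q⁻¹ = 1 := Q.mul_nonsing_inv hdet
  have hQQ' : Q⁻¹ * Q = 1 := Q.nonsing_inv_mul hdet
  refine ⟨Q, hQ, hQ.isUnit, isCorep_conj hv hQQ hQQ', ?_⟩
  let φ := (algebraMap ℂ A).mapMatrix (m := Fin d)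
  have hφ (M : Matrix (Fin d) (Fin d) ℂ) : M.map (algebraMap ℂ A) = φ M := rfl
  have hφstar {M : Matrix (Fin d) (Fin d) ℂ} (hM : M.IsHermitian) :
      (φ M).conjTranspose = φ M := by
    conv_rhs => rw [← hM.eq]
    ext i j
    exact (algebraMap_star_comm (M j i)).symm
  have hinv : v.conjTranspose * (φ Q * φ Q) * v = φ Q * φ Q := by
    have := conjTranspose_mul_averagedGram_mul hstar hh hv
    rwa [← hQP, hφ, map_mul] at this
  have h₁ : φ Q * φ Q⁻¹ = 1 := by rw [← map_mul, hQQ, map_one]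
  have h₂ : φ Q⁻¹ * φ Q = 1 := by rw [← map_mul, hQQ', map_one]
  simp only [hφ]
  have hleft : (φ Q * v * φ Q⁻¹).conjTranspose * (φ Q * v * φ Q⁻¹) = 1 := by
    rw [Matrix.conjTranspose_mul, Matrix.conjTranspose_mul, hφstar hQ.isHermitian,
      hφstar hQ.isHermitian.inv]
    calc _ = φ Q⁻¹ * (v.conjTranspose * (φ Q * φ Q) * v) * φ Q⁻¹ := by
          simp only [mul_assoc]
      _ = (φ Q⁻¹ * φ Q) * (φ Q * φ Q⁻¹) := by rw [hinv]; simp only [mul_assoc]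
      _ = 1 := by rw [h₁, h₂, one_mul]
  have hunit : IsUnit (φ Q * v * φ Q⁻¹) :=
    ((hQ.isUnit.map φ).mul hvinv).mul ((IsUnit.of_mul_eq_one_right _ hQQ).map φ)
  refine isUnitaryMatrix_iff.mpr ⟨?_, hleft⟩
  obtain ⟨u, hu⟩ := hunit
  rw [← hu] at hleft ⊢
  rw [Units.mul_eq_one_iff_inv_eq, Units.inv_eq_of_mul_eq_one_left hleft]
end

section
/- Let h be a faithful Haar state on A, and let u ∈ M_m(A) and v ∈ M_n(A) be inequivalent irreducible unitary corepresentations of A. Then span_ℂ{u_{ij} : 1 ≤ i, j ≤ m} ∩ span_ℂ{v_{kl} : 1 ≤ k, l ≤ n} = {0}; moreover these two subspaces are orthogonal with respect to the inner product ⟨a, b⟩ := h(star(b)·a) on A. -/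
open scoped TensorProduct BigOperators ComplexOrder

/-- The value of `(h ⊗ id) ∘ Δ` on the product of the star of a matrix coefficient with a matrix
coefficient of another corepresentation. -/
theorem applyFst_star_mul {A : Type*} [Ring A] [StarRing A] [HopfAlgebra ℂ A]
    (hstar : ComulStar A) (h : A →ₗ[ℂ] ℂ) {m n : ℕ} {u : Matrix (Fin m) (Fin m) A}
    {v : Matrix (Fin n) (Fin n) A} (hu : IsCorep u) (hv : IsCorep v) (k l : Fin n)
    (i j : Fin m) :
    applyFst h (star (v k l) * u i j) =
      ∑ a, ∑ b, h (star (v k a) * u i b) • (star (v a l) * u b j) := by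
  have hsv := hstar (v k l) n (fun a => v k a) (fun a => v a l) (hv.1 k l)
  simp only [applyFst, LinearMap.comp_apply, Bialgebra.comul_mul, hsv, hu.1 i j,
    Finset.sum_mul_sum, Algebra.TensorProduct.tmul_mul_tmul, map_sum, LinearMap.rTensor_tmul,
    LinearEquiv.coe_coe, TensorProduct.lid_tmul]

/-- Averaging with an invariant functional produces an intertwiner. -/
theorem intertwines_of_applyFst_invariant {A : Type*} [Ring A] [StarRing A] [HopfAlgebra ℂ A]
    (hstar : ComulStar A) (h : A →ₗ[ℂ] ℂ) (hinv : ∀ a : A, applyFst h a = h a • (1 : A))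
    {m n : ℕ} {u : Matrix (Fin m) (Fin m) A} {v : Matrix (Fin n) (Fin n) A}
    (hu : IsCorep u) (hv : IsCorep v) (hvU : IsUnitaryMatrix v) (k : Fin n) (i : Fin m) :
    Intertwines v u (Matrix.of fun c b => h (star (v k c) * u i b)) := by
  intro c j
  simp only [Matrix.of_apply]
  calc ∑ l, h (star (v k l) * u i j) • v c l
      = ∑ l, v c l * ∑ a, ∑ b, h (star (v k a) * u i b) • (star (v a l) * u b j) := by
        refine Finset.sum_congr rfl fun l _ => ?_
        rw [← applyFst_star_mul hstar h hu hv, hinv, mul_smul_comm, mul_one]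
    _ = ∑ a, ∑ b, h (star (v k a) * u i b) • ((∑ l, v c l * star (v a l)) * u b j) := by
        simp only [Finset.mul_sum, Finset.sum_mul, Finset.smul_sum, mul_smul_comm, mul_assoc]
        rw [Finset.sum_comm]
        exact Finset.sum_congr rfl fun a _ => Finset.sum_comm
    _ = ∑ b, h (star (v k c) * u i b) • u b j := by
        simp only [hvU.1]
        rw [Finset.sum_eq_single c (fun a _ hac => by simp [hac.symm]) (by simp)]
        simp

/-- The coefficient spaces of two inequivalent irreducible unitary corepresentations intersect
trivially and are orthogonal for the inner product `⟨a,b⟩ = h(star(b)·a)`. -/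
theorem coeff_spaces_of_inequivalent_orthogonal {A : Type*} [Ring A] [StarRing A]
    [HopfAlgebra ℂ A] [StarModule ℂ A] (hstar : ComulStar A)
    (h : A →ₗ[ℂ] ℂ) (hh : IsHaarState h) (hfaith : ∀ a : A, h (star a * a) = 0 → a = 0)
    {m n : ℕ} {u : Matrix (Fin m) (Fin m) A} {v : Matrix (Fin n) (Fin n) A}
    (hu : IsCorep u) (huU : IsUnitaryMatrix u) (huirr : IsIrreducibleCorep u)
    (hv : IsCorep v) (hvU : IsUnitaryMatrix v) (hvirr : IsIrreducibleCorep v)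
    (hineq : ∀ T : Matrix (Fin m) (Fin n) ℂ, Intertwines u v T → T = 0)
    (hineq' : ∀ T : Matrix (Fin n) (Fin m) ℂ, Intertwines v u T → T = 0)
    (U V : Submodule ℂ A)
    (hU : U = Submodule.span ℂ (Set.range fun p : Fin m × Fin m => u p.1 p.2))
    (hV : V = Submodule.span ℂ (Set.range fun p : Fin n × Fin n => v p.1 p.2)) :
    U ⊓ V = ⊥ ∧ ∀ x ∈ U, ∀ y ∈ V, h (star y * x) = 0 := by
  have hcoef (k l : Fin n) (i j : Fin m) : h (star (v k l) * u i j) = 0 :=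
    congrFun₂ (hineq' _ (intertwines_of_applyFst_invariant hstar h hh.2.2.1 hu hv hvU k i)) l j
  have horth : ∀ x ∈ U, ∀ y ∈ V, h (star y * x) = 0 := by
    subst hU hV
    intro x hx y hy
    induction hy using Submodule.span_induction with
    | zero => simp
    | add y z _ _ hy hz => simp [add_mul, hy, hz]
    | smul c y _ hy => simp [hy]
    | mem y hy =>
      obtain ⟨⟨k, l⟩, rfl⟩ := hy
      induction hx using Submodule.span_induction with
      | zero => simp
      | add x z _ _ hx hz => simp [mul_add, hx, hz]
      | smul c x _ hx => simp [hx]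
      | mem x hx =>
        obtain ⟨⟨i, j⟩, rfl⟩ := hx
        exact hcoef k l i j
  exact ⟨(Submodule.eq_bot_iff _).2 fun x hx => hfaith x (horth x hx.1 x hx.2), horth⟩
end
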